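/- Let N = 1, u ∈ BV²(R), and ρ_n a radially symmetric approximate identity (ρ_n ≥ 0, ∫ρ_n = 1). Define H_n u(x) = ∫_R (u(y) - 2u(x) + u(2x - y))/|x-y|² ρ_n(x-y) dy. Then ∫_R |H_n u(x)| dx ≤ |D²u|(R) for every n (constant exactly 1), and consequently limsup_n |μ_n|(R) ≤ |D²u|(R) where μ_n = H_n u · L¹. -/

import Mathlib

open MeasureTheory

/-- The `L¹` norm of an integrable function is determined by duality against smooth compactly
supported functions bounded by `1`. -/
theorem integral_abs_le_of_forall_integral_mul_le {f : ℝ → ℝ} (hf : Integrable f) {C : ℝ}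
    (h : ∀ φ : ℝ → ℝ, ContDiff ℝ (⊤ : ℕ∞) φ → HasCompactSupport φ → (∀ x, |φ x| ≤ 1) →
      ∫ x, f x * φ x ≤ C) :
    ∫ x, |f x| ≤ C := by
  have key : ∀ ε : ℝ, 0 < ε → ∫ x, |f x| ≤ C + 3 * ε := by
    intro ε hε
    obtain ⟨k, hkc, hks, hk⟩ :=
      (memLp_one_iff_integrable.2 hf).exist_eLpNorm_sub_le ENNReal.one_ne_top le_rfl hε
    have hki : Integrable k := hks.continuous.integrable_of_hasCompactSupport hkc
    have hfk : ∫ x, |f x - k x| ≤ ε := by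
      rw [eLpNorm_one_eq_lintegral_enorm] at hk
      have h1 := ofReal_integral_norm_eq_lintegral_enorm (hf.sub hki)
      rw [← h1, ENNReal.ofReal_le_ofReal_iff hε.le] at hk
      simpa [Real.norm_eq_abs] using hk
    have hfki : Integrable fun x => |f x - k x| := (hf.sub hki).abs
    set c := volume.real (tsupport k) with hc
    have hc0 : 0 ≤ c := measureReal_nonneg
    set δ := ε / (c + 1) with hδ
    have hδ0 : 0 < δ := by positivity
    have hδc : δ * c ≤ ε := by
      rw [hδ, div_mul_eq_mul_div, div_le_iff₀ (by positivity)]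
      nlinarith
    have hsq : ∀ x, 0 < k x ^ 2 + δ ^ 2 := fun x => by positivity
    let φ : ℝ → ℝ := fun x => k x * (√(k x ^ 2 + δ ^ 2))⁻¹
    have hφs : ContDiff ℝ (⊤ : ℕ∞) φ := by
      refine hks.mul (ContDiff.inv ?_ fun x => (Real.sqrt_pos.2 (hsq x)).ne')
      exact ((hks.pow 2).add contDiff_const).sqrt fun x => (hsq x).ne'
    have hφc : HasCompactSupport φ := hkc.mul_right
    have habs : ∀ x, |k x| ≤ √(k x ^ 2 + δ ^ 2) := fun x =>
      Real.abs_le_sqrt (by nlinarith [sq_nonneg δ])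
    have hφ1 : ∀ x, |φ x| ≤ 1 := by
      intro x
      have hp := Real.sqrt_pos.2 (hsq x)
      simp only [φ, abs_mul, abs_inv, abs_of_pos hp]
      rw [← div_eq_mul_inv, div_le_one hp]
      exact habs x
    have hmul : ∀ {w : ℝ → ℝ}, Integrable w → Integrable fun x => w x * φ x := fun hw =>
      hw.mul_bdd (c := 1) hφs.continuous.aestronglyMeasurable
        (Filter.Eventually.of_forall fun x => by simpa using hφ1 x)
    have hKm : MeasurableSet (tsupport k) := (isClosed_tsupport k).measurableSet
    have hKi : Integrable ((tsupport k).indicator fun _ => δ) :=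
      (integrable_indicator_iff hKm).2 (integrableOn_const hkc.isCompact.measure_lt_top.ne)
    have hpt : ∀ x, |k x| ≤ k x * φ x + (tsupport k).indicator (fun _ => δ) x := by
      intro x
      by_cases hx : x ∈ tsupport k
      · rw [Set.indicator_of_mem hx]
        have hp := Real.sqrt_pos.2 (hsq x)
        have hs := Real.sq_sqrt (hsq x).le
        have hle : √(k x ^ 2 + δ ^ 2) ≤ |k x| + δ := by
          rw [Real.sqrt_le_left (by positivity)]
          nlinarith [sq_abs (k x), abs_nonneg (k x)]
        have : k x * φ x = |k x| * (|k x| / √(k x ^ 2 + δ ^ 2)) := by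
          simp only [φ]
          rw [← mul_div_assoc, abs_mul_abs_self]
          ring
        rw [this, ← sub_le_iff_le_add', ← mul_one_sub, one_sub_div hp.ne', mul_div_assoc',
          div_le_iff₀ hp]
        nlinarith [habs x, abs_nonneg (k x)]
      · simp [image_eq_zero_of_notMem_tsupport hx, Set.indicator_of_notMem hx]
    have h1 : ∫ x, |k x| ≤ (∫ x, k x * φ x) + δ * c := by
      have := integral_mono hki.abs ((hmul hki).add hKi) hpt
      rw [integral_add' (hmul hki) hKi, integral_indicator hKm, setIntegral_const,
        smul_eq_mul, mul_comm] at this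
      exact this
    have h2 : ∫ x, k x * φ x ≤ (∫ x, f x * φ x) + ∫ x, |f x - k x| := by
      rw [← integral_add (hmul hf) hfki]
      refine integral_mono (hmul hki) ((hmul hf).add hfki) fun x => ?_
      have : |(f x - k x) * φ x| ≤ |f x - k x| := by
        rw [abs_mul]
        exact mul_le_of_le_one_right (abs_nonneg _) (hφ1 x)
      have h3 := neg_abs_le ((f x - k x) * φ x)
      simp only
      linarith
    have h3 : ∫ x, |f x| ≤ (∫ x, |k x|) + ∫ x, |f x - k x| := by
      rw [← integral_add hki.abs hfki]
      refine integral_mono hf.abs (hki.abs.add hfki) fun x => ?_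
      have := abs_add_le (k x) (f x - k x)
      simpa using this
    linarith [h φ hφs hφc hφ1]
  refine le_of_forall_pos_le_add fun ε hε => ?_
  have := key (ε / 3) (by positivity)
  linarith

/-- A finite difference of a test function is the derivative of a test function. -/
theorem exists_contDiff_deriv_eq_sub {φ : ℝ → ℝ} (hφ : ContDiff ℝ (⊤ : ℕ∞) φ)
    (hc : HasCompactSupport φ) {M : ℝ} (hM : ∀ x, |φ x| ≤ M) (h : ℝ) :
    ∃ ψ : ℝ → ℝ, ContDiff ℝ (⊤ : ℕ∞) ψ ∧ HasCompactSupport ψ ∧ (∀ x, |ψ x| ≤ M * |h|) ∧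
      deriv ψ = fun x => φ (x + h) - φ x := by
  have hcont := hφ.continuous
  have hii : ∀ a b, IntervalIntegrable φ volume a b := fun a b => hcont.intervalIntegrable a b
  let ψ : ℝ → ℝ := fun x => ∫ t in x..(x + h), φ t
  have hd : ∀ x, HasDerivAt ψ (φ (x + h) - φ x) x := by
    intro x
    have hP : ∀ y, HasDerivAt (fun y => ∫ t in (0 : ℝ)..y, φ t) (φ y) y := fun y =>
      intervalIntegral.integral_hasDerivAt_right (hii _ _)
        (hcont.stronglyMeasurableAtFilter _ _) hcont.continuousAt
    have := ((hP (x + h)).comp_add_const x h).sub (hP x)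
    refine this.congr_of_eventuallyEq (Filter.Eventually.of_forall fun y => ?_)
    exact (intervalIntegral.integral_interval_sub_left (hii _ _) (hii _ _)).symm
  have hderiv : deriv ψ = fun x => φ (x + h) - φ x := funext fun x => (hd x).deriv
  refine ⟨ψ, ?_, ?_, fun x => ?_, hderiv⟩
  · rw [contDiff_infty_iff_deriv]
    refine ⟨fun x => (hd x).differentiableAt, ?_⟩
    rw [hderiv]
    exact (hφ.comp (contDiff_id.add contDiff_const)).sub hφ
  · obtain ⟨R, hR⟩ := hc.isCompact.isBounded.subset_closedBall 0
    refine HasCompactSupport.intro (isCompact_closedBall (0 : ℝ) (R + |h|)) fun x hx => ?_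
    refine (intervalIntegral.integral_congr (g := fun _ => (0 : ℝ)) fun t ht => ?_).trans (by simp)
    refine image_eq_zero_of_notMem_tsupport fun hmem => hx ?_
    have h1 := hR hmem
    have h2 := Set.abs_sub_left_of_mem_uIcc ht
    simp only [mem_closedBall_zero_iff, Real.norm_eq_abs, add_sub_cancel_left] at h1 h2 ⊢
    have h3 := abs_sub_abs_le_abs_sub x t
    rw [abs_sub_comm] at h3
    linarith
  · have := intervalIntegral.norm_integral_le_of_norm_le_const (a := x) (b := x + h) (f := φ)
      (C := M) fun t _ => hM t
    simpa using this

/-- The `L¹` norm of the symmetric second difference of `u` with step `h` is at most `h²` times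
the second variation of `u`. -/
theorem integral_abs_second_difference_le {u : ℝ → ℝ} (hu : Integrable u) {V : ℝ}
    (hV : V ∈ upperBounds {r : ℝ | ∃ φ : ℝ → ℝ, ContDiff ℝ (⊤ : ℕ∞) φ ∧ HasCompactSupport φ ∧
      (∀ x, |φ x| ≤ 1) ∧ r = ∫ x, u x * deriv (deriv φ) x}) {h : ℝ} (hh : h ≠ 0) :
    ∫ x, |u (x - h) - 2 * u x + u (x + h)| ≤ h ^ 2 * V := by
  have hum := hu.comp_sub_right h
  have hup := hu.comp_add_right h
  refine integral_abs_le_of_forall_integral_mul_le ((hum.sub (hu.const_mul 2)).add hup)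
    fun φ hφ hφc hφ1 => ?_
  obtain ⟨ψ₁, hs₁, hc₁, hb₁, hd₁⟩ := exists_contDiff_deriv_eq_sub hφ hφc hφ1 h
  obtain ⟨ψ₂, hs₂, hc₂, hb₂, hd₂⟩ := exists_contDiff_deriv_eq_sub hs₁ hc₁ hb₁ (-h)
  have hh2 : 0 < h ^ 2 := by positivity
  have hdd : deriv (deriv ψ₂) = fun x => -(φ (x + h) - 2 * φ x + φ (x - h)) := by
    have hdiff : Differentiable ℝ ψ₁ := hs₁.differentiable (by simp)
    have hshift : Differentiable ℝ fun x => ψ₁ (x + -h) :=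
      hdiff.comp (differentiable_id.add_const (-h))
    ext x
    rw [hd₂, deriv_fun_sub (hshift x) (hdiff x), deriv_comp_add_const, hd₁]
    simp only [← sub_eq_add_neg, sub_add_cancel]
    ring
  have hφi : ∀ {w : ℝ → ℝ} (a : ℝ), Integrable w → Integrable fun x => w x * φ (x + a) :=
    fun a hw => hw.mul_bdd (c := 1)
      (hφ.continuous.comp (continuous_id.add continuous_const)).aestronglyMeasurable
      (Filter.Eventually.of_forall fun x => by simpa using hφ1 (x + a))
  have hm : ∫ x, u (x - h) * φ x = ∫ x, u x * φ (x + h) := by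
    rw [← integral_add_right_eq_self _ h]
    simp
  have hp : ∫ x, u (x + h) * φ x = ∫ x, u x * φ (x - h) := by
    rw [← integral_sub_right_eq_self _ h]
    simp
  have i0 : ∀ {w : ℝ → ℝ}, Integrable w → Integrable fun x => w x * φ x := fun hw => by
    simpa using hφi 0 hw
  have hkey : ∫ x, (u (x - h) - 2 * u x + u (x + h)) * φ x
      = h ^ 2 * ∫ x, u x * deriv (deriv fun x => (-(h ^ 2)⁻¹) * ψ₂ x) x := by
    have e1 : (deriv fun x => (-(h ^ 2)⁻¹) * ψ₂ x) = fun x => (-(h ^ 2)⁻¹) * deriv ψ₂ x :=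
      funext fun x => deriv_const_mul_field _
    have e2 : (deriv fun x => (-(h ^ 2)⁻¹) * deriv ψ₂ x)
        = fun x => (-(h ^ 2)⁻¹) * deriv (deriv ψ₂) x :=
      funext fun x => deriv_const_mul_field _
    rw [e1, e2, hdd, ← integral_const_mul]
    have l : ∀ x, (u (x - h) - 2 * u x + u (x + h)) * φ x
        = u (x - h) * φ x - 2 * (u x * φ x) + u (x + h) * φ x := fun x => by ring
    have r : ∀ x, h ^ 2 * (u x * (-(h ^ 2)⁻¹ * -(φ (x + h) - 2 * φ x + φ (x - h))))
        = u x * φ (x + h) - 2 * (u x * φ x) + u x * φ (x - h) := fun x => by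
      field_simp
    simp only [l, r]
    have j1 : Integrable fun x => u x * φ (x - h) := by
      simpa [sub_eq_add_neg] using hφi (-h) hu
    have j2 : Integrable fun x => u (x - h) * φ x - 2 * (u x * φ x) :=
      (i0 hum).sub ((i0 hu).const_mul 2)
    have j3 : Integrable fun x => u x * φ (x + h) - 2 * (u x * φ x) :=
      (hφi h hu).sub ((i0 hu).const_mul 2)
    rw [integral_add j2 (i0 hup), integral_sub (i0 hum) ((i0 hu).const_mul 2), integral_add j3 j1,
      integral_sub (hφi h hu) ((i0 hu).const_mul 2), hm, hp]
  refine hkey.trans_le ?_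
  refine mul_le_mul_of_nonneg_left (hV ⟨_, contDiff_const.mul hs₂, hc₂.mul_left, fun x => ?_, rfl⟩)
    hh2.le
  have := hb₂ x
  rw [abs_mul, abs_neg, abs_inv, abs_of_pos hh2, ← div_eq_inv_mul, div_le_one hh2]
  rwa [abs_neg, one_mul, abs_mul_abs_self, ← sq] at this

/-- The one-dimensional non-local Hessian is bounded in `L¹` by the second variation. -/
theorem integral_abs_nonlocal_hessian_le {u : ℝ → ℝ} (hu : Integrable u) {V : ℝ}
    (hV : V ∈ upperBounds {r : ℝ | ∃ φ : ℝ → ℝ, ContDiff ℝ (⊤ : ℕ∞) φ ∧ HasCompactSupport φ ∧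
      (∀ x, |φ x| ≤ 1) ∧ r = ∫ x, u x * deriv (deriv φ) x})
    {ρ : ℝ → ℝ} (hρ0 : ∀ z, 0 ≤ ρ z) (hρi : Integrable ρ) (hρ1 : ∫ z, ρ z = 1) :
    ∫ x, |∫ y, (u y - 2 * u x + u (x + (x - y))) / |x - y| ^ 2 * ρ (x - y)| ≤ V := by
  have hV0 : 0 ≤ V := hV ⟨fun _ => 0, contDiff_const, HasCompactSupport.zero, by simp, by simp⟩
  have hcov : ∀ x, ∫ y, (u y - 2 * u x + u (x + (x - y))) / |x - y| ^ 2 * ρ (x - y)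
      = ∫ z, (u (x - z) - 2 * u x + u (x + z)) / |z| ^ 2 * ρ z := by
    intro x
    rw [← integral_sub_left_eq_self _ volume x]
    simp
  simp only [hcov]
  let F : ℝ → ℝ → ℝ := fun x z => (u (x - z) - 2 * u x + u (x + z)) / |z| ^ 2 * ρ z
  have hFm : AEStronglyMeasurable (Function.uncurry F) (volume.prod volume) := by
    have m1 : AEStronglyMeasurable (fun p : ℝ × ℝ => u (p.1 - p.2)) (volume.prod volume) :=
      hu.aestronglyMeasurable.comp_quasiMeasurePreserving
        (quasiMeasurePreserving_sub volume volume)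
    have m2 : AEStronglyMeasurable (fun p : ℝ × ℝ => u (p.1 + p.2)) (volume.prod volume) :=
      hu.aestronglyMeasurable.comp_quasiMeasurePreserving
        (quasiMeasurePreserving_add volume volume)
    have m3 : AEStronglyMeasurable (fun p : ℝ × ℝ => u p.1) (volume.prod volume) :=
      hu.aestronglyMeasurable.comp_fst
    have m4 : AEStronglyMeasurable (fun p : ℝ × ℝ => ρ p.2) (volume.prod volume) :=
      hρi.aestronglyMeasurable.comp_snd
    have m5 : AEStronglyMeasurable (fun p : ℝ × ℝ => (|p.2| ^ 2)⁻¹) (volume.prod volume) :=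
      (by fun_prop : Measurable fun p : ℝ × ℝ => (|p.2| ^ 2)⁻¹).aestronglyMeasurable
    exact (((m1.sub (m3.const_mul 2)).add m2).mul m5).mul m4
  have hslice : ∀ z, ∫⁻ x, ‖F x z‖ₑ ≤ ENNReal.ofReal (V * ρ z) := by
    intro z
    rcases eq_or_ne z 0 with rfl | hz
    · simp [F]
    have hi : Integrable fun x => F x z :=
      ((((hu.comp_sub_right z).sub (hu.const_mul 2)).add (hu.comp_add_right z)).div_const
        _).mul_const _
    rw [← ofReal_integral_norm_eq_lintegral_enorm hi]
    refine ENNReal.ofReal_le_ofReal ?_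
    have hz2 : 0 < z ^ 2 := by positivity
    simp only [F, Real.norm_eq_abs, abs_mul, abs_div, sq_abs, abs_of_nonneg (hρ0 z),
      abs_of_pos hz2]
    rw [integral_mul_const, integral_div]
    refine mul_le_mul_of_nonneg_right ?_ (hρ0 z)
    rw [div_le_iff₀' hz2]
    exact integral_abs_second_difference_le hu hV hz
  have htot : ∫⁻ x, ‖∫ z, F x z‖ₑ ≤ ENNReal.ofReal V :=
    calc ∫⁻ x, ‖∫ z, F x z‖ₑ ≤ ∫⁻ x, ∫⁻ z, ‖F x z‖ₑ :=
          lintegral_mono fun x => enorm_integral_le_lintegral_enorm _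
      _ = ∫⁻ z, ∫⁻ x, ‖F x z‖ₑ := lintegral_lintegral_swap hFm.enorm
      _ ≤ ∫⁻ z, ENNReal.ofReal (V * ρ z) := lintegral_mono hslice
      _ = ENNReal.ofReal V := by
          rw [← ofReal_integral_eq_lintegral_ofReal (hρi.const_mul V)
            (Filter.Eventually.of_forall fun z => mul_nonneg hV0 (hρ0 z)),
            integral_const_mul, hρ1, mul_one]
  have hm : AEStronglyMeasurable fun x => ∫ z, F x z := hFm.integral_prod_right'
  change ∫ x, ‖∫ z, F x z‖ ≤ V
  rw [integral_norm_eq_lintegral_enorm hm]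
  exact ENNReal.toReal_le_of_le_ofReal hV0 htot

/-- In dimension one, for `u ∈ BV²(ℝ)` (with weak derivative `g ∈ L¹` and second variation
`V = |D²u|(ℝ)` given by its dual characterization) and radially symmetric approximate
identities `ρ n`, the non-local Hessians `H_n u(x) = ∫ (u(y) - 2u(x) + u(2x-y))/|x-y|² ρ_n(x-y) dy`
satisfy `∫ |H_n u| ≤ |D²u|(ℝ)` for every `n`, and hence
`limsup_n |μ_n|(ℝ) ≤ |D²u|(ℝ)`. -/
theorem oneD_nonlocal_hessian_L1_bound (u g : ℝ → ℝ) (V : ℝ) (ρ : ℕ → ℝ → ℝ)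
    (hu : Integrable u) (hg : Integrable g)
    (hweak : ∀ φ : ℝ → ℝ, ContDiff ℝ (⊤ : ℕ∞) φ → HasCompactSupport φ →
      (∫ x, u x * deriv φ x) = -∫ x, g x * φ x)
    (hV : IsLUB {r : ℝ | ∃ φ : ℝ → ℝ, ContDiff ℝ (⊤ : ℕ∞) φ ∧ HasCompactSupport φ ∧
      (∀ x, |φ x| ≤ 1) ∧ r = ∫ x, u x * deriv (deriv φ) x} V)
    (hρ : ∀ n, (∀ z, 0 ≤ ρ n z) ∧ (∀ z, ρ n (-z) = ρ n z) ∧ Integrable (ρ n) ∧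
      (∫ z, ρ n z) = 1) :
    (∀ n, (∫ x, |∫ y, (u y - 2 * u x + u (x + (x - y))) / |x - y| ^ 2 * ρ n (x - y)|) ≤ V) ∧
    Filter.limsup (fun n =>
        ∫ x, |∫ y, (u y - 2 * u x + u (x + (x - y))) / |x - y| ^ 2 * ρ n (x - y)|)
      Filter.atTop ≤ V := by
  have hmain : ∀ n, (∫ x, |∫ y, (u y - 2 * u x + u (x + (x - y))) / |x - y| ^ 2 * ρ n (x - y)|)
      ≤ V := fun n =>
    integral_abs_nonlocal_hessian_le hu hV.1 (hρ n).1 (hρ n).2.2.1 (hρ n).2.2.2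
  refine ⟨hmain, Filter.limsup_le_of_le ?_ (Filter.Eventually.of_forall hmain)⟩
  exact Filter.isCoboundedUnder_le_of_le Filter.atTop (x := 0) fun n =>
    integral_nonneg fun x => abs_nonneg _
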